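/- arXiv:2501.17136 — 3 statements merged into one kernel-verified Lean document; each statement's English description precedes it below -/
import Mathlib

section
/- For every integer r ≥ 2 the equation x_1 + 2x_2 − x_3 − 2x_4 = 0 is r-uncommon over the integers: there exist δ > 0 and N₀ such that for every n ≥ N₀ there is a coloring c : {1,…,n} → {1,…,r} with r^{3} · #{(x_1,x_2,x_3,x_4) ∈ {1,…,n}^4 : x_1 + 2x_2 − x_3 − 2x_4 = 0 and c(x_1) = c(x_2) = c(x_3) = c(x_4)} ≤ (1 − δ) · #{(x_1,x_2,x_3,x_4) ∈ {1,…,n}^4 : x_1 + 2x_2 − x_3 − 2x_4 = 0}. -/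
open Finset

/-- Perturbation profile on twelve consecutive blocks. -/
def blockProfile (a : ℤ) : ℤ :=
  [1, -5, 5, 4, -5, 0, 0, -5, 4, 5, -5, 1].getD a.toNat 0

/-- The product of the four values `50 + blockProfile` plus that of the values `50 - blockProfile`,
minus the unperturbed value. -/
def excess (a b c d : ℤ) : ℤ :=
  (50 + blockProfile a) * (50 + blockProfile b) * (50 + blockProfile c) * (50 + blockProfile d) +
  (50 - blockProfile a) * (50 - blockProfile b) * (50 - blockProfile c) * (50 - blockProfile d) -
  2 * 50 ^ 4

/-- Coefficient of `p ^ 3` in `sum_tent_shift`. -/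
def cubicCoeff (k : ℤ) : ℤ := if k = 0 then 4 else if k = 1 ∨ k = -1 then 1 else 0

/-- Coefficient of `p` in `sum_tent_shift`. -/
def linearCoeff (k : ℤ) : ℤ := if k = 0 then 2 else if k = 1 ∨ k = -1 then -1 else 0

/-- Sum of `F a * F b` over the block indices `a`, `b` with `a + 2b = s`. -/
noncomputable def blockConv (F : ℤ → ℤ) (s : ℤ) : ℤ :=
  ∑ b ∈ Ico (0 : ℤ) 12, if s - 2 * b ∈ Ico (0 : ℤ) 12 then F (s - 2 * b) * F b else 0

lemma sum_mul_eq_sum_blockConv (F φ : ℤ → ℤ) :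
    ∑ a ∈ Ico (0 : ℤ) 12, ∑ b ∈ Ico (0 : ℤ) 12, F a * F b * φ (a + 2 * b) =
      ∑ s ∈ Ico (0 : ℤ) 34, blockConv F s * φ s := by
  simp_rw [blockConv, Finset.sum_mul]
  rw [Finset.sum_comm, Finset.sum_comm (s := Ico (0 : ℤ) 34)]
  refine Finset.sum_congr rfl fun b hb => ?_
  simp_rw [ite_mul, zero_mul]
  rw [← Finset.sum_filter]
  rw [mem_Ico] at hb
  refine Finset.sum_nbij' (fun a => a + 2 * b) (fun s => s - 2 * b) ?_ ?_ ?_ ?_ ?_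
  · intro a ha
    simp only [mem_filter, mem_Ico] at ha ⊢
    omega
  · intro s hs
    exact (mem_filter.1 hs).2
  · intro a _
    ring
  · intro s _
    ring
  · intro a _
    rw [add_sub_cancel_right]

lemma sum_mul_mul_eq_sum_blockConv (F w : ℤ → ℤ) :
    ∑ a ∈ Ico (0 : ℤ) 12, ∑ b ∈ Ico (0 : ℤ) 12, ∑ c ∈ Ico (0 : ℤ) 12, ∑ d ∈ Ico (0 : ℤ) 12,
      F a * F b * F c * F d * w (a + 2 * b - c - 2 * d) =
    ∑ s ∈ Ico (0 : ℤ) 34, ∑ t ∈ Ico (0 : ℤ) 34, blockConv F s * blockConv F t * w (s - t) := by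
  have h : ∀ a b : ℤ, ∑ c ∈ Ico (0 : ℤ) 12, ∑ d ∈ Ico (0 : ℤ) 12,
      F a * F b * F c * F d * w (a + 2 * b - c - 2 * d) =
      F a * F b * ∑ t ∈ Ico (0 : ℤ) 34, blockConv F t * w (a + 2 * b - t) := by
    intro a b
    rw [← sum_mul_eq_sum_blockConv F fun t => w (a + 2 * b - t)]
    simp_rw [Finset.mul_sum]
    refine Finset.sum_congr rfl fun c _ => Finset.sum_congr rfl fun d _ => ?_
    rw [← sub_sub]
    ring
  simp_rw [h]
  rw [sum_mul_eq_sum_blockConv F fun s => ∑ t ∈ Ico (0 : ℤ) 34, blockConv F t * w (s - t)]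
  simp_rw [Finset.mul_sum, mul_assoc]

/-- Values of `blockConv (fun a => 50 + blockProfile a)`. -/
def plusConv (s : ℤ) : ℤ :=
  [2601, 2295, 5100, 4779, 7575, 7455, 10354, 9945, 12744, 12521, 14930, 14931, 15020, 14950,
    14936, 15025, 14839, 14839, 15025, 14936, 14950, 15020, 14931, 14930, 12521, 12744, 9945,
    10354, 7455, 7575, 4779, 5100, 2295, 2601].getD s.toNat 0

lemma blockConv_eq_plusConv : ∀ s ∈ Ico (0 : ℤ) 34,
    blockConv (fun a => 50 + blockProfile a) s = plusConv s := by
  decide +kernel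

/-- Values of `blockConv (fun a => 50 - blockProfile a)`. -/
def minusConv (s : ℤ) : ℤ :=
  [2401, 2695, 4900, 5279, 7375, 7455, 9754, 10045, 12244, 12621, 14930, 14931, 15120, 15050,
    15036, 15125, 15039, 15039, 15125, 15036, 15050, 15120, 14931, 14930, 12621, 12244, 10045,
    9754, 7455, 7375, 5279, 4900, 2695, 2401].getD s.toNat 0

lemma blockConv_eq_minusConv : ∀ s ∈ Ico (0 : ℤ) 34,
    blockConv (fun a => 50 - blockProfile a) s = minusConv s := by
  decide +kernel

/-- Values of `blockConv (fun _ => 50)`. -/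
def constConv (s : ℤ) : ℤ :=
  [2500, 2500, 5000, 5000, 7500, 7500, 10000, 10000, 12500, 12500, 15000, 15000, 15000, 15000,
    15000, 15000, 15000, 15000, 15000, 15000, 15000, 15000, 15000, 15000, 12500, 12500, 10000,
    10000, 7500, 7500, 5000, 5000, 2500, 2500].getD s.toNat 0

lemma blockConv_eq_constConv : ∀ s ∈ Ico (0 : ℤ) 34,
    blockConv (fun _ => 50) s = constConv s := by
  decide +kernel

lemma sum_excess_mul (w : ℤ → ℤ) :
    ∑ a ∈ Ico (0 : ℤ) 12, ∑ b ∈ Ico (0 : ℤ) 12, ∑ c ∈ Ico (0 : ℤ) 12, ∑ d ∈ Ico (0 : ℤ) 12,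
      excess a b c d * w (a + 2 * b - c - 2 * d) =
    ∑ s ∈ Ico (0 : ℤ) 34, ∑ t ∈ Ico (0 : ℤ) 34,
      (plusConv s * plusConv t + minusConv s * minusConv t - 2 * (constConv s * constConv t)) *
        w (s - t) := by
  have h : ∀ a b c d k, excess a b c d * w k =
      (50 + blockProfile a) * (50 + blockProfile b) * (50 + blockProfile c) *
        (50 + blockProfile d) * w k +
      (50 - blockProfile a) * (50 - blockProfile b) * (50 - blockProfile c) *
        (50 - blockProfile d) * w k - 2 * (50 * 50 * 50 * 50 * w k) := fun a b c d k => by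
    rw [excess]
    ring
  have h0 := sum_mul_mul_eq_sum_blockConv (fun _ => 50) w
  simp_rw [← Finset.mul_sum] at h0
  simp_rw [h, Finset.sum_sub_distrib, Finset.sum_add_distrib, ← Finset.mul_sum]
  rw [sum_mul_mul_eq_sum_blockConv (fun a => 50 + blockProfile a),
    sum_mul_mul_eq_sum_blockConv (fun a => 50 - blockProfile a),
    h0, Finset.mul_sum, ← Finset.sum_add_distrib,
    ← Finset.sum_sub_distrib]
  refine Finset.sum_congr rfl fun s hs => ?_
  rw [Finset.mul_sum, ← Finset.sum_add_distrib, ← Finset.sum_sub_distrib]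
  refine Finset.sum_congr rfl fun t ht => ?_
  rw [blockConv_eq_plusConv s hs, blockConv_eq_plusConv t ht, blockConv_eq_minusConv s hs,
    blockConv_eq_minusConv t ht, blockConv_eq_constConv s hs, blockConv_eq_constConv t ht]
  ring

lemma sum_excess_mul_cubicCoeff :
    ∑ a ∈ Ico (0 : ℤ) 12, ∑ b ∈ Ico (0 : ℤ) 12, ∑ c ∈ Ico (0 : ℤ) 12, ∑ d ∈ Ico (0 : ℤ) 12,
    excess a b c d * (2 * cubicCoeff (a + 2 * b - c - 2 * d) +
      cubicCoeff (a + 2 * b - c - 2 * d + 1) +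
      cubicCoeff (a + 2 * b - c - 2 * d - 1)) = -542056 := by
  rw [sum_excess_mul fun k => 2 * cubicCoeff k + cubicCoeff (k + 1) + cubicCoeff (k - 1)]
  decide +kernel

lemma sum_excess_mul_linearCoeff :
    ∑ a ∈ Ico (0 : ℤ) 12, ∑ b ∈ Ico (0 : ℤ) 12, ∑ c ∈ Ico (0 : ℤ) 12, ∑ d ∈ Ico (0 : ℤ) 12,
    excess a b c d * (2 * linearCoeff (a + 2 * b - c - 2 * d) +
      linearCoeff (a + 2 * b - c - 2 * d + 1) +
      linearCoeff (a + 2 * b - c - 2 * d - 1)) ≤ 0 := by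
  rw [sum_excess_mul fun k => 2 * linearCoeff k + linearCoeff (k + 1) + linearCoeff (k - 1)]
  decide +kernel

lemma sum_affine_update {X : Type*} [DecidableEq X] {r : ℕ} (p : X → Fin r → ℝ) (v : X)
    (hv : ∑ i, p v i = 1) (x : Fin 4 → X) (hx : Function.Injective x) (i : Fin r) :
    ∑ k, p v k * ∏ j, Function.update p v (Pi.single k 1) (x j) i = ∏ j, p (x j) i := by
  by_cases h : ∃ j, x j = v
  · obtain ⟨j, rfl⟩ := h
    have key : ∀ k, ∏ l, Function.update p (x j) (Pi.single k 1) (x l) i =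
        (Pi.single k 1 : Fin r → ℝ) i * ∏ l ∈ univ.erase j, p (x l) i := by
      intro k
      rw [← Finset.mul_prod_erase univ _ (mem_univ j), Function.update_self]
      congr 1
      refine Finset.prod_congr rfl fun l hl => ?_
      rw [Function.update_of_ne]
      exact fun e => (Finset.ne_of_mem_erase hl) (hx e)
    simp_rw [key, ← mul_assoc]
    rw [← Finset.sum_mul, ← Finset.mul_prod_erase univ _ (mem_univ j)]
    congr 1
    simp [Pi.single_apply]
  · push Not at h
    have key : ∀ k, ∏ l, Function.update p v (Pi.single k 1) (x l) i = ∏ l, p (x l) i := by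
      intro k
      refine Finset.prod_congr rfl fun l _ => ?_
      rw [Function.update_of_ne (h l)]
    simp_rw [key]
    rw [← Finset.sum_mul, hv, one_mul]

lemma exists_update_le {X : Type*} [DecidableEq X] {r : ℕ} (p : X → Fin r → ℝ)
    (hp0 : ∀ v i, 0 ≤ p v i) (hp1 : ∀ v, ∑ i, p v i = 1) (S : Finset (Fin 4 → X))
    (hS : ∀ x ∈ S, Function.Injective x) (v : X) :
    ∃ k, ∑ x ∈ S, ∑ i, ∏ j, Function.update p v (Pi.single k 1) (x j) i ≤
      ∑ x ∈ S, ∑ i, ∏ j, p (x j) i := by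
  by_contra! h
  set F := ∑ x ∈ S, ∑ i, ∏ j, p (x j) i with hF
  have h1 : ∑ k, p v k * (∑ x ∈ S, ∑ i, ∏ j, Function.update p v (Pi.single k 1) (x j) i) = F := by
    simp_rw [Finset.mul_sum]
    rw [Finset.sum_comm]
    refine Finset.sum_congr rfl fun x hx => ?_
    rw [Finset.sum_comm]
    exact Finset.sum_congr rfl fun i _ => sum_affine_update p v (hp1 v) x (hS x hx) i
  have h2 : ∑ k, p v k * F = F := by rw [← Finset.sum_mul, hp1, one_mul]
  obtain ⟨k, hk⟩ : ∃ k, 0 < p v k := by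
    by_contra! h0
    have := Finset.sum_nonpos fun k (_ : k ∈ univ) => h0 k
    linarith [hp1 v]
  have : ∑ k, p v k * F <
      ∑ k, p v k * (∑ x ∈ S, ∑ i, ∏ j, Function.update p v (Pi.single k 1) (x j) i) :=
    Finset.sum_lt_sum (fun k _ => mul_le_mul_of_nonneg_left (h k).le (hp0 v k))
      ⟨k, mem_univ k, mul_lt_mul_of_pos_left (h k) hk⟩
  linarith

lemma exists_deterministic_on {X : Type*} [DecidableEq X] {r : ℕ} (p : X → Fin r → ℝ)
    (hp0 : ∀ v i, 0 ≤ p v i) (hp1 : ∀ v, ∑ i, p v i = 1) (S : Finset (Fin 4 → X))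
    (hS : ∀ x ∈ S, Function.Injective x) (V : Finset X) :
    ∃ q : X → Fin r → ℝ, (∀ v i, 0 ≤ q v i) ∧ (∀ v, ∑ i, q v i = 1) ∧
      (∀ v ∈ V, ∃ k, q v = Pi.single k 1) ∧
      ∑ x ∈ S, ∑ i, ∏ j, q (x j) i ≤ ∑ x ∈ S, ∑ i, ∏ j, p (x j) i := by
  induction V using Finset.induction_on with
  | empty => exact ⟨p, hp0, hp1, by simp, le_rfl⟩
  | insert v V _ ih =>
    obtain ⟨q, hq0, hq1, hqV, hq⟩ := ih
    obtain ⟨k, hk⟩ := exists_update_le q hq0 hq1 S hS v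
    refine ⟨Function.update q v (Pi.single k 1), ?_, ?_, ?_, hk.trans hq⟩
    · intro w i
      by_cases hw : w = v
      · subst hw
        rw [Function.update_self, Pi.single_apply]
        split_ifs <;> norm_num
      · rw [Function.update_of_ne hw]
        exact hq0 w i
    · intro w
      by_cases hw : w = v
      · subst hw
        simp
      · rw [Function.update_of_ne hw]
        exact hq1 w
    · intro w hw
      by_cases hwv : w = v
      · subst hwv
        exact ⟨k, Function.update_self ..⟩
      · rw [Function.update_of_ne hwv]
        exact hqV w ((Finset.mem_insert.1 hw).resolve_left hwv)

/-- Derandomization: independent random colours with distributions `p v` can be replaced by a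
deterministic colouring with at most the expected number of monochromatic tuples. -/
lemma exists_coloring_card_le {X : Type*} [DecidableEq X] {r : ℕ} (p : X → Fin r → ℝ)
    (hp0 : ∀ v i, 0 ≤ p v i) (hp1 : ∀ v, ∑ i, p v i = 1) (S : Finset (Fin 4 → X))
    (hS : ∀ x ∈ S, Function.Injective x) :
    ∃ c : X → Fin r,
      ((S.filter fun x => c (x 0) = c (x 1) ∧ c (x 1) = c (x 2) ∧ c (x 2) = c (x 3)).card : ℝ) ≤
        ∑ x ∈ S, ∑ i, ∏ j, p (x j) i := by
  obtain ⟨q, hq0, hq1, hqV, hq⟩ :=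
    exists_deterministic_on p hp0 hp1 S hS (S.biUnion fun x => univ.image x)
  have hex : ∀ v, ∃ k, v ∈ (S.biUnion fun x => univ.image x) → q v = Pi.single k 1 := by
    intro v
    by_cases hv : v ∈ (S.biUnion fun x => univ.image x)
    · exact (hqV v hv).imp fun k hk _ => hk
    · have : Nonempty (Fin r) := by
        by_contra hne
        have := not_nonempty_iff.1 hne
        simpa using hp1 v
      exact ⟨this.some, fun h => absurd h hv⟩
  choose c hc using hex
  refine ⟨c, le_trans ?_ hq⟩
  rw [Finset.card_filter]
  push_cast
  refine Finset.sum_le_sum fun x hx => ?_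
  have hnn : ∀ i, 0 ≤ ∏ j, q (x j) i := fun i => Finset.prod_nonneg fun j _ => hq0 _ _
  split_ifs with h
  · refine le_trans ?_ (Finset.single_le_sum (fun i _ => hnn i) (mem_univ (c (x 0))))
    have hcx : ∀ j, q (x j) = Pi.single (c (x j)) 1 := fun j =>
      hc _ (Finset.mem_biUnion.2 ⟨x, hx, Finset.mem_image_of_mem _ (mem_univ j)⟩)
    simp [Fin.prod_univ_four, hcx, h.1, h.2.1, h.2.2]
  · exact Finset.sum_nonneg fun i _ => hnn i

lemma sum_Ico_zero_eq_sum_range (p : ℕ) (f : ℤ → ℤ) :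
    ∑ x ∈ Ico (0 : ℤ) p, f x = ∑ i ∈ range p, f i := by
  refine Finset.sum_nbij' Int.toNat (fun i : ℕ => (i : ℤ)) ?_ ?_ ?_ ?_ ?_
  all_goals simp only [mem_Ico, mem_range]
  · intro a ha; omega
  · intro a ha; omega
  · intro a ha; omega
  · intro a ha; omega
  · intro a ha; rw [Int.toNat_of_nonneg ha.1]

lemma sum_Ico_ite_sub_eq (m : ℕ) (s : ℤ) :
    ∑ a ∈ Ico (0 : ℤ) m, ∑ c ∈ Ico (0 : ℤ) m, (if a - c = s then (1 : ℤ) else 0) =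
      max (m - |s|) 0 := by
  have h : ∀ a, ∑ c ∈ Ico (0 : ℤ) m, (if a - c = s then (1 : ℤ) else 0) =
      if a - s ∈ Ico (0 : ℤ) m then 1 else 0 := by
    intro a
    rw [← Finset.sum_ite_eq' (Ico (0 : ℤ) m) (a - s) fun _ => (1 : ℤ)]
    refine Finset.sum_congr rfl fun c _ => ?_
    congr 1
    exact propext ⟨fun h => by omega, fun h => by omega⟩
  simp_rw [h]
  rw [← Finset.sum_filter, Finset.sum_const, nsmul_one]
  have : (Ico (0 : ℤ) m).filter (fun a => a - s ∈ Ico (0 : ℤ) m) =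
      Ico (max 0 s) (min m (m + s)) := by
    ext a
    simp only [mem_filter, mem_Ico]
    omega
  rw [this, Int.card_Ico]
  rcases abs_cases s with ⟨h, _⟩ | ⟨h, _⟩ <;> rw [h] <;> omega

lemma sum_range_sub_cast (p : ℕ) :
    2 * ∑ u ∈ range p, ((p : ℤ) - u) = p * (p + 1) := by
  induction p with
  | zero => simp
  | succ p ih =>
    rw [Finset.sum_range_succ]
    have : ∑ u ∈ range p, (((p + 1 : ℕ) : ℤ) - u) = ∑ u ∈ range p, ((p : ℤ) - u) + p := by
      have h : ∀ u : ℕ, (((p + 1 : ℕ) : ℤ) - u) = ((p : ℤ) - u) + 1 := fun u => by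
        push_cast; ring
      simp_rw [h, Finset.sum_add_distrib]
      simp
    rw [this]
    push_cast
    linarith

lemma sum_posPart_sub (p : ℕ) :
    6 * ∑ u ∈ range p, ∑ v ∈ range p, max ((v : ℤ) - u) 0 = (p : ℤ) ^ 3 - p := by
  induction p with
  | zero => simp
  | succ p ih =>
    simp_rw [Finset.sum_range_succ _ p, Finset.sum_add_distrib]
    have h1 : ∑ u ∈ range p, max ((p : ℤ) - u) 0 = ∑ u ∈ range p, ((p : ℤ) - u) := by
      refine Finset.sum_congr rfl fun u hu => max_eq_left ?_
      have := mem_range.1 hu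
      omega
    have h2 : ∑ v ∈ range p, max ((v : ℤ) - p) 0 = 0 := by
      refine Finset.sum_eq_zero fun u hu => max_eq_right ?_
      have := mem_range.1 hu
      omega
    rw [h1, h2]
    have := sum_range_sub_cast p
    simp only [sub_self, max_self]
    push_cast
    linarith

lemma sum_tent_shift (p : ℕ) (l : ℤ) :
    6 * ∑ u ∈ range p, ∑ v ∈ range p, max ((p : ℤ) - |(v : ℤ) - u - p * l|) 0 =
      cubicCoeff l * (p : ℤ) ^ 3 + linearCoeff l * p := by
  have hT := sum_posPart_sub p
  have hT' : ∑ u ∈ range p, ∑ v ∈ range p, max ((u : ℤ) - v) 0 =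
    ∑ u ∈ range p, ∑ v ∈ range p, max ((v : ℤ) - u) 0 := Finset.sum_comm
  set T := ∑ u ∈ range p, ∑ v ∈ range p, max ((v : ℤ) - u) 0 with hTdef
  by_cases h0 : l = 0
  · subst h0
    have : ∑ u ∈ range p, ∑ v ∈ range p, max ((p : ℤ) - |(v : ℤ) - u - p * 0|) 0 =
        ∑ u ∈ range p, ∑ v ∈ range p, ((p : ℤ) - max ((v : ℤ) - u) 0 - max ((u : ℤ) - v) 0) := by
      refine Finset.sum_congr rfl fun u hu => Finset.sum_congr rfl fun v hv => ?_
      rw [mem_range] at hu hv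
      rw [mul_zero, sub_zero]
      rcases abs_cases ((v : ℤ) - u) with ⟨h, _⟩ | ⟨h, _⟩ <;> rw [h] <;> omega
    rw [this]
    simp_rw [Finset.sum_sub_distrib]
    rw [hT', ← hTdef]
    simp [cubicCoeff, linearCoeff]
    linarith
  by_cases h1 : l = 1
  · subst h1
    have : ∑ u ∈ range p, ∑ v ∈ range p, max ((p : ℤ) - |(v : ℤ) - u - p * 1|) 0 = T := by
      refine Finset.sum_congr rfl fun u hu => Finset.sum_congr rfl fun v hv => ?_
      rw [mem_range] at hu hv
      rw [mul_one, abs_of_nonpos (by omega)]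
      congr 1
      ring
    rw [this]
    simp [cubicCoeff, linearCoeff]
    linarith
  by_cases h2 : l = -1
  · subst h2
    have : ∑ u ∈ range p, ∑ v ∈ range p, max ((p : ℤ) - |(v : ℤ) - u - p * (-1)|) 0 = T := by
      rw [← hT']
      refine Finset.sum_congr rfl fun u hu => Finset.sum_congr rfl fun v hv => ?_
      rw [mem_range] at hu hv
      rw [abs_of_nonneg (by omega)]
      congr 1
      ring
    rw [this]
    simp [cubicCoeff, linearCoeff]
    linarith
  · have : ∑ u ∈ range p, ∑ v ∈ range p, max ((p : ℤ) - |(v : ℤ) - u - p * l|) 0 = 0 := by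
      refine Finset.sum_eq_zero fun u hu => Finset.sum_eq_zero fun v hv => max_eq_right ?_
      rw [mem_range] at hu hv
      rcases (by omega : 2 ≤ l ∨ l ≤ -2) with h | h
      · have := le_abs_self (-((v : ℤ) - u - p * l))
        rw [abs_neg] at this
        nlinarith
      · have := le_abs_self ((v : ℤ) - u - p * l)
        nlinarith
    rw [this]
    simp [cubicCoeff, linearCoeff, h0, h1, h2]

lemma sum_range_two_mul (p : ℕ) (f : ℕ → ℤ) :
    ∑ x ∈ range (2 * p), f x = ∑ x ∈ range p, f x + ∑ x ∈ range p, f (p + x) := by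
  rw [two_mul, Finset.sum_range_add]

/-- The number of solutions of `a + 2b - c - 2d = -2pk` in `{0, …, 2p - 1}`. -/
lemma block_count (p : ℕ) (k : ℤ) :
    3 * ∑ a ∈ Ico (0 : ℤ) (2 * p : ℕ), ∑ b ∈ Ico (0 : ℤ) (2 * p : ℕ),
        ∑ c ∈ Ico (0 : ℤ) (2 * p : ℕ), ∑ d ∈ Ico (0 : ℤ) (2 * p : ℕ),
        (if a + 2 * b - c - 2 * d + (2 * p : ℕ) * k = 0 then (1 : ℤ) else 0) =
      (2 * cubicCoeff k + cubicCoeff (k + 1) + cubicCoeff (k - 1)) * (p : ℤ) ^ 3 +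
      (2 * linearCoeff k + linearCoeff (k + 1) + linearCoeff (k - 1)) * p := by
  set I := Ico (0 : ℤ) (2 * p : ℕ) with hI
  have h1 : ∑ a ∈ I, ∑ b ∈ I, ∑ c ∈ I, ∑ d ∈ I,
      (if a + 2 * b - c - 2 * d + (2 * p : ℕ) * k = 0 then (1 : ℤ) else 0) =
      ∑ b ∈ I, ∑ d ∈ I, ∑ a ∈ I, ∑ c ∈ I, (if a - c = 2 * (d - b - p * k) then (1 : ℤ) else 0) := by
    rw [Finset.sum_comm]
    refine Finset.sum_congr rfl fun b _ => ?_
    calc _ = ∑ a ∈ I, ∑ d ∈ I, ∑ c ∈ I, _ :=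
          Finset.sum_congr rfl fun a _ => Finset.sum_comm
      _ = ∑ d ∈ I, ∑ a ∈ I, ∑ c ∈ I, _ := Finset.sum_comm
      _ = _ := by
          refine Finset.sum_congr rfl fun d _ => Finset.sum_congr rfl fun a _ =>
            Finset.sum_congr rfl fun c _ => ?_
          congr 1
          push_cast
          exact propext ⟨fun h => by linarith, fun h => by linarith⟩
  have h2 : ∀ b d : ℤ, ∑ a ∈ I, ∑ c ∈ I, (if a - c = 2 * (d - b - p * k) then (1 : ℤ) else 0) =
      2 * max ((p : ℤ) - |d - b - p * k|) 0 := by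
    intro b d
    rw [hI, sum_Ico_ite_sub_eq, abs_mul, abs_two]
    push_cast
    omega
  rw [h1]
  simp_rw [h2, hI, sum_Ico_zero_eq_sum_range, sum_range_two_mul, Finset.sum_add_distrib,
    ← Finset.mul_sum]
  have e1 := sum_tent_shift p k
  have e2 := sum_tent_shift p (k + 1)
  have e3 := sum_tent_shift p (k - 1)
  have s1 : ∀ u v : ℕ, (v : ℤ) - (p + u : ℕ) - p * k = v - u - p * (k + 1) := fun u v => by
    push_cast; ring
  have s2 : ∀ u v : ℕ, ((p + v : ℕ) : ℤ) - u - p * k = v - u - p * (k - 1) := fun u v => by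
    push_cast; ring
  have s3 : ∀ u v : ℕ, ((p + v : ℕ) : ℤ) - (p + u : ℕ) - p * k = v - u - p * k := fun u v => by
    push_cast; ring
  simp_rw [s3, s1, s2]
  linarith

/-- Solutions of `x₁ + 2x₂ - x₃ - 2x₄ = 0` in `{1, …, n}`. -/
noncomputable def solutions (n : ℕ) : Finset (Fin 4 → ℤ) :=
  (Fintype.piFinset fun _ : Fin 4 => Icc (1 : ℤ) n).filter
    fun x => x 0 + 2 * x 1 - x 2 - 2 * x 3 = 0

lemma sum_piFinset_four {α M : Type*} [DecidableEq α] [AddCommMonoid M] (s : Finset α)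
    (f : (Fin 4 → α) → M) :
    ∑ x ∈ Fintype.piFinset fun _ : Fin 4 => s, f x =
      ∑ a ∈ s, ∑ b ∈ s, ∑ c ∈ s, ∑ d ∈ s, f ![a, b, c, d] := by
  simp_rw [← Finset.sum_product']
  refine Finset.sum_nbij' (fun x => (x 0, x 1, x 2, x 3))
    (fun t => ![t.1, t.2.1, t.2.2.1, t.2.2.2]) ?_ ?_ ?_ ?_ ?_
  · intro x hx
    have := Fintype.mem_piFinset.1 hx
    simp [this]
  · rintro ⟨a, b, c, d⟩ h
    simp only [mem_product] at h
    rw [Fintype.mem_piFinset]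
    intro j
    fin_cases j <;> simp [h]
  · intro x _
    ext j
    fin_cases j <;> rfl
  · rintro ⟨a, b, c, d⟩ _
    rfl
  · intro x _
    congr 1
    ext j
    fin_cases j <;> rfl

lemma sum_piFinset_blocks {ι M : Type*} [Fintype ι] [DecidableEq ι] [AddCommMonoid M]
    (N m : ℕ) (hm : 0 < m) (F : (ι → ℤ) → M) :
    ∑ x ∈ Fintype.piFinset fun _ : ι => Icc (1 : ℤ) (N * m : ℕ), F x =
      ∑ a ∈ Fintype.piFinset fun _ : ι => Ico (0 : ℤ) N,
        ∑ u ∈ Fintype.piFinset fun _ : ι => Ico (0 : ℤ) m, F fun j => m * a j + u j + 1 := by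
  rw [← Finset.sum_product']
  have hm' : (0 : ℤ) < m := by exact_mod_cast hm
  refine Finset.sum_nbij' (fun x => (fun j => (x j - 1) / m, fun j => (x j - 1) % m))
    (fun t j => m * t.1 j + t.2 j + 1) ?_ ?_ ?_ ?_ ?_
  · intro x hx
    simp only [mem_product, Fintype.mem_piFinset, mem_Ico, mem_Icc] at hx ⊢
    refine ⟨fun j => ⟨Int.ediv_nonneg (by linarith [(hx j).1]) hm'.le, ?_⟩,
      fun j => ⟨Int.emod_nonneg _ hm'.ne', Int.emod_lt_of_pos _ hm'⟩⟩
    have := (hx j).2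
    push_cast at this
    exact Int.ediv_lt_of_lt_mul hm' (by linarith)
  · rintro ⟨a, u⟩ h
    simp only [mem_product, Fintype.mem_piFinset, mem_Ico, mem_Icc] at h ⊢
    intro j
    obtain ⟨ha, hu⟩ := h.1 j, h.2 j
    push_cast
    constructor <;> nlinarith
  · intro x _
    ext j
    simp only
    linarith [Int.mul_ediv_add_emod (x j - 1) m]
  · rintro ⟨a, u⟩ h
    simp only [mem_product, Fintype.mem_piFinset, mem_Ico] at h
    have h1 : ∀ j, (m * a j + u j + 1 - 1) / m = a j := fun j => by
      rw [add_sub_cancel_right, Int.add_comm, Int.add_mul_ediv_left _ _ hm'.ne',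
        Int.ediv_eq_zero_of_lt (h.2 j).1 (h.2 j).2, zero_add]
    have h2 : ∀ j, (m * a j + u j + 1 - 1) % m = u j := fun j => by
      rw [add_sub_cancel_right, Int.add_comm, Int.add_mul_emod_self_left,
        Int.emod_eq_of_lt (h.2 j).1 (h.2 j).2]
    simp only [h1, h2]
  · intro x _
    congr 1
    ext j
    linarith [Int.mul_ediv_add_emod (x j - 1) m]

lemma sum_piFinset_four_blocks {M : Type*} [AddCommMonoid M] (N m : ℕ) (hm : 0 < m)
    (F : (Fin 4 → ℤ) → M) :
    ∑ x ∈ Fintype.piFinset fun _ : Fin 4 => Icc (1 : ℤ) (N * m : ℕ), F x =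
      ∑ a ∈ Ico (0 : ℤ) N, ∑ b ∈ Ico (0 : ℤ) N, ∑ c ∈ Ico (0 : ℤ) N, ∑ d ∈ Ico (0 : ℤ) N,
        ∑ s ∈ Ico (0 : ℤ) m, ∑ t ∈ Ico (0 : ℤ) m, ∑ u ∈ Ico (0 : ℤ) m, ∑ v ∈ Ico (0 : ℤ) m,
          F ![m * a + s + 1, m * b + t + 1, m * c + u + 1, m * d + v + 1] := by
  rw [sum_piFinset_blocks N m hm, sum_piFinset_four]
  refine Finset.sum_congr rfl fun a _ => Finset.sum_congr rfl fun b _ =>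
    Finset.sum_congr rfl fun c _ => Finset.sum_congr rfl fun d _ => ?_
  rw [sum_piFinset_four]
  refine Finset.sum_congr rfl fun s _ => Finset.sum_congr rfl fun t _ =>
    Finset.sum_congr rfl fun u _ => Finset.sum_congr rfl fun v _ => ?_
  congr 1
  ext j
  fin_cases j <;> rfl

/-- Sum of `excess`, evaluated on block indices, over the solutions with block vector `(a, b, c, d)`
for blocks of length `2p`. -/
lemma sum_excess_block (p : ℕ) (hp : 0 < p) (a b c d : ℤ) :
    3 * ∑ s ∈ Ico (0 : ℤ) (2 * p : ℕ), ∑ t ∈ Ico (0 : ℤ) (2 * p : ℕ),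
        ∑ u ∈ Ico (0 : ℤ) (2 * p : ℕ), ∑ v ∈ Ico (0 : ℤ) (2 * p : ℕ),
        (if ((2 * p : ℕ) * a + s + 1) + 2 * ((2 * p : ℕ) * b + t + 1)
            - ((2 * p : ℕ) * c + u + 1) - 2 * ((2 * p : ℕ) * d + v + 1) = 0 then
          excess (((2 * p : ℕ) * a + s + 1 - 1) / (2 * p : ℕ))
            (((2 * p : ℕ) * b + t + 1 - 1) / (2 * p : ℕ))
            (((2 * p : ℕ) * c + u + 1 - 1) / (2 * p : ℕ))
            (((2 * p : ℕ) * d + v + 1 - 1) / (2 * p : ℕ)) else 0) =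
      excess a b c d * (2 * cubicCoeff (a + 2 * b - c - 2 * d) +
        cubicCoeff (a + 2 * b - c - 2 * d + 1) +
        cubicCoeff (a + 2 * b - c - 2 * d - 1)) * (p : ℤ) ^ 3 +
      excess a b c d * (2 * linearCoeff (a + 2 * b - c - 2 * d) +
        linearCoeff (a + 2 * b - c - 2 * d + 1) +
        linearCoeff (a + 2 * b - c - 2 * d - 1)) * p := by
  have hm : (0 : ℤ) < (2 * p : ℕ) := by positivity
  have hdiv : ∀ a : ℤ, ∀ u ∈ Ico (0 : ℤ) (2 * p : ℕ),
      ((2 * p : ℕ) * a + u + 1 - 1) / (2 * p : ℕ) = a := fun a u hu => by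
    rw [mem_Ico] at hu
    rw [add_sub_cancel_right, Int.add_comm, Int.add_mul_ediv_left _ _ hm.ne',
      Int.ediv_eq_zero_of_lt hu.1 hu.2, zero_add]
  rw [mul_assoc, mul_assoc, ← mul_add, ← block_count, mul_left_comm]
  congr 1
  simp_rw [Finset.mul_sum]
  refine Finset.sum_congr rfl fun s hs => Finset.sum_congr rfl fun t ht =>
    Finset.sum_congr rfl fun u hu => Finset.sum_congr rfl fun v hv => ?_
  rw [hdiv a s hs, hdiv b t ht, hdiv c u hu, hdiv d v hv, mul_ite, mul_one, mul_zero]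
  congr 1
  exact propext ⟨fun h => by linarith, fun h => by linarith⟩

lemma sum_excess_le (p : ℕ) (hp : 0 < p) :
    3 * ∑ x ∈ solutions (12 * (2 * p)),
      excess ((x 0 - 1) / (2 * p : ℕ)) ((x 1 - 1) / (2 * p : ℕ)) ((x 2 - 1) / (2 * p : ℕ))
        ((x 3 - 1) / (2 * p : ℕ)) ≤ -542056 * (p : ℤ) ^ 3 := by
  rw [solutions, Finset.sum_filter, sum_piFinset_four_blocks 12 (2 * p) (by positivity)]
  calc _ = ∑ a ∈ Ico (0 : ℤ) 12, ∑ b ∈ Ico (0 : ℤ) 12, ∑ c ∈ Ico (0 : ℤ) 12,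
        ∑ d ∈ Ico (0 : ℤ) 12,
        (excess a b c d * (2 * cubicCoeff (a + 2 * b - c - 2 * d) +
          cubicCoeff (a + 2 * b - c - 2 * d + 1) +
          cubicCoeff (a + 2 * b - c - 2 * d - 1)) * (p : ℤ) ^ 3 +
        excess a b c d * (2 * linearCoeff (a + 2 * b - c - 2 * d) +
          linearCoeff (a + 2 * b - c - 2 * d + 1) +
          linearCoeff (a + 2 * b - c - 2 * d - 1)) * p) := by
        rw [Finset.mul_sum]
        refine Finset.sum_congr rfl fun a _ => ?_
        rw [Finset.mul_sum]
        refine Finset.sum_congr rfl fun b _ => ?_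
        rw [Finset.mul_sum]
        refine Finset.sum_congr rfl fun c _ => ?_
        rw [Finset.mul_sum]
        exact Finset.sum_congr rfl fun d _ => sum_excess_block p hp a b c d
    _ ≤ _ := by
        simp_rw [Finset.sum_add_distrib, ← Finset.sum_mul]
        rw [sum_excess_mul_cubicCoeff]
        have := mul_le_mul_of_nonneg_right sum_excess_mul_linearCoeff (Int.natCast_nonneg p)
        linarith

lemma mem_solutions {n : ℕ} {x : Fin 4 → ℤ} :
    x ∈ solutions n ↔
      (∀ j, 1 ≤ x j ∧ x j ≤ n) ∧ x 0 + 2 * x 1 - x 2 - 2 * x 3 = 0 := by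
  simp [solutions, Fintype.mem_piFinset]

lemma solutions_mono {m n : ℕ} (h : m ≤ n) : solutions m ⊆ solutions n := by
  intro x hx
  rw [mem_solutions] at hx ⊢
  exact ⟨fun j => ⟨(hx.1 j).1, (hx.1 j).2.trans (by exact_mod_cast h)⟩, hx.2⟩

lemma card_solutions_le (n : ℕ) : (solutions n).card ≤ n ^ 3 := by
  have h : (solutions n).card ≤ (Icc (1 : ℤ) n ×ˢ Icc (1 : ℤ) n ×ˢ Icc (1 : ℤ) n).card := by
    refine Finset.card_le_card_of_injOn (fun x => (x 0, x 1, x 3)) ?_ ?_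
    · intro x hx
      have := (mem_solutions.1 hx).1
      simp [this]
    · intro x hx y hy hxy
      have h1 := (mem_solutions.1 hx).2
      have h2 := (mem_solutions.1 hy).2
      simp only [Prod.mk.injEq] at hxy
      ext j
      fin_cases j <;> simp <;> omega
  simpa [pow_succ, mul_assoc] using h

lemma card_solutions_filter_eq_le (n : ℕ) (i j : Fin 4) (hij : i ≠ j) :
    ((solutions n).filter fun x => x i = x j).card ≤ n ^ 2 := by
  have h (k l : Fin 4)
      (hinj : ∀ x y : Fin 4 → ℤ, x 0 + 2 * x 1 - x 2 - 2 * x 3 = 0 →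
        y 0 + 2 * y 1 - y 2 - 2 * y 3 = 0 → x i = x j → y i = y j → x k = y k → x l = y l →
        x 0 = y 0 ∧ x 1 = y 1 ∧ x 2 = y 2 ∧ x 3 = y 3) :
      ((solutions n).filter fun x => x i = x j).card ≤ n ^ 2 := by
    have h : ((solutions n).filter fun x => x i = x j).card ≤
        (Icc (1 : ℤ) n ×ˢ Icc (1 : ℤ) n).card := by
      refine Finset.card_le_card_of_injOn (fun x => (x k, x l)) ?_ ?_
      · intro x hx
        have := (mem_solutions.1 (mem_filter.1 hx).1).1
        simp [this]
      · intro x hx y hy hxy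
        obtain ⟨hx, hx'⟩ := mem_filter.1 hx
        obtain ⟨hy, hy'⟩ := mem_filter.1 hy
        simp only [Prod.mk.injEq] at hxy
        have := hinj x y (mem_solutions.1 hx).2 (mem_solutions.1 hy).2 hx' hy' hxy.1 hxy.2
        ext j
        fin_cases j <;> simp [this]
    simpa [pow_two] using h
  fin_cases i <;> fin_cases j <;> first
    | exact absurd rfl hij
    | exact h 0 1 (by simp only [Fin.mk_one, Fin.zero_eta, Fin.reduceFinMk]; intros; omega)
    | exact h 0 2 (by simp only [Fin.mk_one, Fin.zero_eta]; intros; omega)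

lemma card_solutions_filter_lt_le (k n : ℕ) (j : Fin 4) :
    ((solutions n).filter fun x => (k : ℤ) < x j).card ≤ (n - k) * n ^ 2 := by
  have h (a b : Fin 4)
      (hinj : ∀ x y : Fin 4 → ℤ, x 0 + 2 * x 1 - x 2 - 2 * x 3 = 0 →
        y 0 + 2 * y 1 - y 2 - 2 * y 3 = 0 → x j = y j → x a = y a → x b = y b →
        x 0 = y 0 ∧ x 1 = y 1 ∧ x 2 = y 2 ∧ x 3 = y 3) :
      ((solutions n).filter fun x => (k : ℤ) < x j).card ≤ (n - k) * n ^ 2 := by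
    have h : ((solutions n).filter fun x => (k : ℤ) < x j).card ≤
        (Ioc (k : ℤ) n ×ˢ Icc (1 : ℤ) n ×ˢ Icc (1 : ℤ) n).card := by
      refine Finset.card_le_card_of_injOn (fun x => (x j, x a, x b)) ?_ ?_
      · intro x hx
        obtain ⟨hx, hx'⟩ := mem_filter.1 hx
        have := (mem_solutions.1 hx).1
        simp [this, hx']
      · intro x hx y hy hxy
        simp only [Prod.mk.injEq] at hxy
        have := hinj x y (mem_solutions.1 (mem_filter.1 hx).1).2
          (mem_solutions.1 (mem_filter.1 hy).1).2 hxy.1 hxy.2.1 hxy.2.2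
        ext j
        fin_cases j <;> simp [this]
    refine h.trans (le_of_eq ?_)
    rw [card_product, card_product, Int.card_Ioc, Int.card_Icc]
    rw [pow_two]
    congr 1
    · omega
    · simp
  fin_cases j
  · exact h 1 2 (by simp only [Fin.zero_eta]; intros; omega)
  · exact h 0 2 (by simp only [Fin.mk_one]; intros; omega)
  · exact h 0 1 (by simp only [Fin.reduceFinMk]; intros; omega)
  · exact h 0 1 (by simp only [Fin.reduceFinMk]; intros; omega)

/-- All but `O(n²)` solutions in `{1, …, n}` have distinct coordinates and lie in `{1, …, k}`. -/
lemma card_solutions_sdiff_le (k n : ℕ) :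
    (solutions n \ (solutions k).filter Function.Injective).card ≤ (12 + 4 * (n - k)) * n ^ 2 := by
  classical
  have hsub : solutions n \ (solutions k).filter Function.Injective ⊆
      ((univ : Finset (Fin 4)).offDiag.biUnion fun q =>
        (solutions n).filter fun x => x q.1 = x q.2) ∪
      (univ : Finset (Fin 4)).biUnion fun j => (solutions n).filter fun x => (k : ℤ) < x j := by
    intro x hx
    obtain ⟨hx, hx'⟩ := mem_sdiff.1 hx
    simp only [mem_union, mem_biUnion, mem_offDiag, mem_univ, true_and, mem_filter, hx]
    by_contra! h
    refine hx' (mem_filter.2 ⟨?_, ?_⟩)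
    · have hx := mem_solutions.1 hx
      exact mem_solutions.2 ⟨fun j => ⟨(hx.1 j).1, h.2 j⟩, hx.2⟩
    · intro i j hij
      by_contra hne
      exact h.1 (i, j) hne hij
  refine (card_le_card hsub).trans ((card_union_le _ _).trans ?_)
  rw [add_mul]
  refine add_le_add ?_ ?_
  · refine (card_biUnion_le_card_mul _ _ (n ^ 2) fun q hq => ?_).trans (le_of_eq ?_)
    · exact card_solutions_filter_eq_le n q.1 q.2 (mem_offDiag.1 hq).2.2
    · rw [offDiag_card]
      simp
  · refine (card_biUnion_le_card_mul _ _ _ fun j _ =>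
      card_solutions_filter_lt_le k n j).trans (le_of_eq ?_)
    simp [mul_assoc]

lemma abs_blockProfile_le (a : ℤ) : |blockProfile a| ≤ 5 := by
  unfold blockProfile
  generalize a.toNat = n
  rcases lt_or_ge n 12 with h | h
  · interval_cases n <;> simp
  · rw [List.getD_eq_default _ _ (by simpa using h)]
    simp

/-- Color distribution of `x`: the colors `0` and `1` are biased in opposite directions by the
profile of the block of length `m` containing `x`. -/
noncomputable def colorWeight (r m : ℕ) (x : ℤ) (i : Fin r) : ℝ :=
  (if i.val = 0 then 50 + (blockProfile ((x - 1) / m) : ℝ)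
    else if i.val = 1 then 50 - (blockProfile ((x - 1) / m) : ℝ) else 50) / (50 * r)

lemma colorWeight_nonneg (r m : ℕ) (x : ℤ) (i : Fin r) : 0 ≤ colorWeight r m x i := by
  have h : |(blockProfile ((x - 1) / m) : ℝ)| ≤ 5 := by
    exact_mod_cast abs_blockProfile_le _
  obtain ⟨h1, h2⟩ := abs_le.1 h
  unfold colorWeight
  refine div_nonneg ?_ (by positivity)
  split_ifs <;> linarith

lemma sum_ite_val {r : ℕ} (hr : 2 ≤ r) (A B C : ℝ) :
    ∑ i : Fin r, (if i.val = 0 then A else if i.val = 1 then B else C) =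
      A + B + (r - 2) * C := by
  obtain ⟨s, rfl⟩ := Nat.exists_eq_add_of_le' hr
  rw [Fin.sum_univ_succ, Fin.sum_univ_succ]
  simp [add_assoc]

lemma sum_colorWeight {r : ℕ} (hr : 2 ≤ r) (m : ℕ) (x : ℤ) : ∑ i, colorWeight r m x i = 1 := by
  unfold colorWeight
  have : (r : ℝ) ≠ 0 := by positivity
  rw [← Finset.sum_div, sum_ite_val hr]
  field_simp
  ring

lemma sum_prod_colorWeight {r : ℕ} (hr : 2 ≤ r) (m : ℕ) (x : Fin 4 → ℤ) :
    (r : ℝ) ^ 3 * ∑ i, ∏ j, colorWeight r m (x j) i =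
      1 + (excess ((x 0 - 1) / m) ((x 1 - 1) / m) ((x 2 - 1) / m) ((x 3 - 1) / m) : ℝ) /
        (50 ^ 4 * r) := by
  have hr0 : (r : ℝ) ≠ 0 := by positivity
  set f : Fin 4 → ℝ := fun j => (blockProfile ((x j - 1) / m) : ℝ) with hf
  have h : ∀ i : Fin r, ∏ j, colorWeight r m (x j) i =
      (if i.val = 0 then (50 + f 0) * (50 + f 1) * (50 + f 2) * (50 + f 3)
        else if i.val = 1 then (50 - f 0) * (50 - f 1) * (50 - f 2) * (50 - f 3)
        else 50 ^ 4) / (50 * r) ^ 4 := by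
    intro i
    simp only [Fin.prod_univ_four, colorWeight, hf]
    split_ifs <;> ring
  simp_rw [h]
  rw [← Finset.sum_div, sum_ite_val hr, excess]
  push_cast
  simp only [hf]
  field_simp
  ring

lemma exists_coloring_card_solutions_le {r : ℕ} (hr : 2 ≤ r) (n : ℕ) (hn : 24 ≤ n) :
    ∃ c : ℤ → Fin r,
      (r : ℝ) ^ 3 * (((solutions n).filter fun x =>
          c (x 0) = c (x 1) ∧ c (x 1) = c (x 2) ∧ c (x 2) = c (x 3)).card : ℝ) ≤
        (solutions n).card + 108 * r ^ 3 * n ^ 2 -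
          542056 * ((n / 24 : ℕ) : ℝ) ^ 3 / (3 * 50 ^ 4 * r) := by
  classical
  set p := n / 24 with hp
  have hp0 : 0 < p := by omega
  set K := 12 * (2 * p) with hK
  have hKn : K ≤ n := by omega
  set S := (solutions K).filter Function.Injective with hS
  obtain ⟨c, hc⟩ := exists_coloring_card_le (colorWeight r (2 * p)) (colorWeight_nonneg r (2 * p))
    (sum_colorWeight hr (2 * p)) S fun x hx => (mem_filter.1 hx).2
  refine ⟨c, ?_⟩
  set mono : (Fin 4 → ℤ) → Prop :=
    fun x => c (x 0) = c (x 1) ∧ c (x 1) = c (x 2) ∧ c (x 2) = c (x 3) with hmono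
  have hsplit : ((solutions n).filter mono).card ≤
      (S.filter mono).card + (solutions n \ S).card := by
    refine (card_le_card (t := S.filter mono ∪ solutions n \ S) fun x hx => ?_).trans
      (card_union_le _ _)
    obtain ⟨hx, hx'⟩ := mem_filter.1 hx
    by_cases h : x ∈ S
    · exact mem_union_left _ (mem_filter.2 ⟨h, hx'⟩)
    · exact mem_union_right _ (mem_sdiff.2 ⟨hx, h⟩)
  have hbad : (solutions n \ S).card ≤ 108 * n ^ 2 :=
    (card_solutions_sdiff_le K n).trans (Nat.mul_le_mul_right _ (by omega))
  have hexp : ∑ x ∈ S, ∑ i, ∏ j, colorWeight r (2 * p) (x j) i ≤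
      ∑ x ∈ solutions K, ∑ i, ∏ j, colorWeight r (2 * p) (x j) i :=
    Finset.sum_le_sum_of_subset_of_nonneg (filter_subset _ _) fun x _ _ =>
      Finset.sum_nonneg fun i _ => Finset.prod_nonneg fun j _ => colorWeight_nonneg r (2 * p) _ i
  have hsum : (r : ℝ) ^ 3 * ∑ x ∈ solutions K, ∑ i, ∏ j, colorWeight r (2 * p) (x j) i ≤
      (solutions K).card - 542056 * (p : ℝ) ^ 3 / (3 * 50 ^ 4 * r) := by
    rw [Finset.mul_sum]
    simp_rw [sum_prod_colorWeight hr]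
    rw [Finset.sum_add_distrib, ← Finset.sum_div, Finset.sum_const, nsmul_one]
    have h := sum_excess_le p hp0
    rw [← hK, ← @Int.cast_le ℝ] at h
    push_cast at h
    have hr0 : (0 : ℝ) < 3 * 50 ^ 4 * r := by positivity
    have h' := div_le_div_of_nonneg_right h hr0.le
    rw [mul_assoc 3, mul_div_mul_left _ _ (by norm_num : (3 : ℝ) ≠ 0), ← mul_assoc 3,
      neg_mul, neg_div] at h'
    push_cast
    linarith
  have hcard : ((solutions K).card : ℝ) ≤ (solutions n).card := by
    exact_mod_cast card_le_card (solutions_mono hKn)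
  have hsplit' : (((solutions n).filter mono).card : ℝ) ≤
      (S.filter mono).card + 108 * (n : ℝ) ^ 2 := by
    exact_mod_cast hsplit.trans (Nat.add_le_add_left hbad _)
  calc (r : ℝ) ^ 3 * (((solutions n).filter mono).card : ℝ)
      ≤ (r : ℝ) ^ 3 * (∑ x ∈ solutions K, ∑ i, ∏ j, colorWeight r (2 * p) (x j) i +
          108 * (n : ℝ) ^ 2) :=
        mul_le_mul_of_nonneg_left (by linarith) (by positivity)
    _ ≤ _ := by linarith

/-- The equation `x₁ + 2x₂ - x₃ - 2x₄ = 0` is `r`-uncommon over the integers for every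
`r ≥ 2`. -/
theorem one_two_equation_r_uncommon
    (r : ℕ) (hr : 2 ≤ r) :
    ∃ δ : ℝ, 0 < δ ∧ ∃ N₀ : ℕ, ∀ n : ℕ, N₀ ≤ n →
      ∃ c : ℤ → Fin r,
        (r : ℝ) ^ 3 *
          (((Fintype.piFinset fun _ : Fin 4 => Finset.Icc (1 : ℤ) n).filter
            (fun x => (x 0 + 2 * x 1 - x 2 - 2 * x 3 = 0) ∧
              c (x 0) = c (x 1) ∧ c (x 1) = c (x 2) ∧ c (x 2) = c (x 3))).card : ℝ)
        ≤ (1 - δ) *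
          (((Fintype.piFinset fun _ : Fin 4 => Finset.Icc (1 : ℤ) n).filter
            (fun x => x 0 + 2 * x 1 - x 2 - 2 * x 3 = 0)).card : ℝ) := by
  have hr0 : (0 : ℝ) < r := by positivity
  refine ⟨1 / (10 ^ 7 * r), by positivity, 108 * 10 ^ 7 * r ^ 4, fun n hn => ?_⟩
  have hr4 : 1 ≤ r ^ 4 := Nat.one_le_pow _ _ (by omega)
  have hn48 : 48 ≤ n := by linarith
  obtain ⟨c, hc⟩ := exists_coloring_card_solutions_le hr n (by omega)
  refine ⟨c, ?_⟩
  rw [← Finset.filter_filter]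
  change (r : ℝ) ^ 3 * (((solutions n).filter fun x =>
    c (x 0) = c (x 1) ∧ c (x 1) = c (x 2) ∧ c (x 2) = c (x 3)).card : ℝ) ≤
      (1 - 1 / (10 ^ 7 * r)) * ((solutions n).card : ℝ)
  refine hc.trans ?_
  have hcard : ((solutions n).card : ℝ) ≤ n ^ 3 := by exact_mod_cast card_solutions_le n
  have hp : (n : ℝ) ≤ 48 * ((n / 24 : ℕ) : ℝ) := by
    exact_mod_cast (by omega : n ≤ 48 * (n / 24))
  have hp3 : (n : ℝ) ^ 3 ≤ 110592 * ((n / 24 : ℕ) : ℝ) ^ 3 := by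
    refine (pow_le_pow_left₀ (by positivity) hp 3).trans (le_of_eq ?_)
    ring
  have hmain : 2 * (n : ℝ) ^ 3 / (10 ^ 7 * r) ≤
      542056 * ((n / 24 : ℕ) : ℝ) ^ 3 / (3 * 50 ^ 4 * r) := by
    rw [div_le_div_iff₀ (by positivity) (by positivity)]
    have h := mul_le_mul_of_nonneg_right hp3 hr0.le
    have h0 : 0 ≤ ((n / 24 : ℕ) : ℝ) ^ 3 * r := by positivity
    linarith
  have hn' : (108 * 10 ^ 7 * r ^ 4 : ℝ) ≤ n := by exact_mod_cast hn
  have herr : 108 * (r : ℝ) ^ 3 * n ^ 2 ≤ (n : ℝ) ^ 3 / (10 ^ 7 * r) := by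
    rw [le_div_iff₀ (by positivity)]
    have h := mul_le_mul_of_nonneg_right hn' (by positivity : (0 : ℝ) ≤ (n : ℝ) ^ 2)
    linarith
  have hδ : 1 / (10 ^ 7 * r) * ((solutions n).card : ℝ) ≤ (n : ℝ) ^ 3 / (10 ^ 7 * r) := by
    rw [div_mul_eq_mul_div, one_mul]
    exact div_le_div_of_nonneg_right hcard (by positivity)
  have h2 : 2 * (n : ℝ) ^ 3 / (10 ^ 7 * r) =
      (n : ℝ) ^ 3 / (10 ^ 7 * r) + (n : ℝ) ^ 3 / (10 ^ 7 * r) := by ring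
  linarith
end

section
/- Let G be a finite abelian group, k ≥ 1, and let a_1, …, a_k be integers. Suppose the equation L : a_1x_1 + ⋯ + a_kx_k = 0 is Sidorenko in G, i.e., for every subset A ⊆ G, |G|^k · #{(x_1,…,x_k) ∈ A^k : a_1·x_1 + ⋯ + a_k·x_k = 0} ≥ |A|^k · #{(x_1,…,x_k) ∈ G^k : a_1·x_1 + ⋯ + a_k·x_k = 0}. Then for every integer r ≥ 1 and every coloring c : G → {1,…,r}, r^{k−1} · #{(x_1,…,x_k) ∈ G^k : a_1·x_1 + ⋯ + a_k·x_k = 0 and c(x_1) = ⋯ = c(x_k)} ≥ #{(x_1,…,x_k) ∈ G^k : a_1·x_1 + ⋯ + a_k·x_k = 0}. (That is, a Sidorenko equation is r-common in G for every r.) -/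
theorem card_filter_and_forall_eq {G : Type*} [Fintype G] [DecidableEq G] {k r : ℕ} (hk : 1 ≤ k)
    (P : (Fin k → G) → Prop) [DecidablePred P] (c : G → Fin r) :
    (Finset.univ.filter (fun x : Fin k → G => P x ∧ ∀ i j, c (x i) = c (x j))).card =
      ∑ t, (Finset.univ.filter (fun x : Fin k → G =>
        (∀ i, x i ∈ Finset.univ.filter (fun g => c g = t)) ∧ P x)).card := by
  rw [Finset.card_eq_sum_card_fiberwise (f := fun x => c (x ⟨0, hk⟩)) (t := Finset.univ)
    (by simp [Set.MapsTo])]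
  refine Finset.sum_congr rfl fun t _ => congrArg Finset.card ?_
  ext x
  simp only [Finset.mem_filter, Finset.mem_univ, true_and]
  constructor
  · rintro ⟨⟨hP, hc⟩, ht⟩
    exact ⟨fun i => (hc i _).trans ht, hP⟩
  · rintro ⟨hc, hP⟩
    exact ⟨⟨hP, fun i j => (hc i).trans (hc j).symm⟩, hc _⟩


/-- If a linear equation is Sidorenko in a finite abelian group `G`, then it is `r`-common
in `G` for every `r ≥ 1`: every `r`-coloring of `G` has at least `r^(1-k)` times the total
number of solutions many monochromatic solutions. -/
theorem sidorenko_implies_r_common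
    (G : Type*) [AddCommGroup G] [Fintype G] [DecidableEq G]
    (k : ℕ) (hk : 1 ≤ k) (a : Fin k → ℤ)
    (hSid : ∀ A : Finset G,
      (Fintype.card G) ^ k *
        (Finset.univ.filter (fun x : Fin k → G =>
          (∀ i, x i ∈ A) ∧ ∑ i, a i • x i = 0)).card
      ≥ A.card ^ k *
        (Finset.univ.filter (fun x : Fin k → G => ∑ i, a i • x i = 0)).card)
    (r : ℕ) (hr : 1 ≤ r) (c : G → Fin r) :
    r ^ (k - 1) *
      (Finset.univ.filter (fun x : Fin k → G =>
        (∑ i, a i • x i = 0) ∧ ∀ i j, c (x i) = c (x j))).card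
    ≥ (Finset.univ.filter (fun x : Fin k → G => ∑ i, a i • x i = 0)).card := by
  have hcard : ∑ t, (Finset.univ.filter (fun g => c g = t)).card = Fintype.card G :=
    (Finset.card_eq_sum_card_fiberwise (by simp [Set.MapsTo])).symm
  have hmean := pow_sum_le_card_mul_sum_pow (s := Finset.univ)
    (f := fun t => (Finset.univ.filter (fun g => c g = t)).card) (fun _ _ => Nat.zero_le _) (k - 1)
  rw [Nat.sub_add_cancel hk, hcard, Finset.card_univ, Fintype.card_fin, Nat.cast_id] at hmean
  have hsum := Finset.sum_le_sum fun t (_ : t ∈ Finset.univ) =>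
    hSid (Finset.univ.filter (fun g => c g = t))
  rw [← Finset.sum_mul, ← Finset.mul_sum] at hsum
  rw [card_filter_and_forall_eq hk]
  refine Nat.le_of_mul_le_mul_left ?_ (pow_pos (Fintype.card_pos (α := G)) k)
  refine (Nat.mul_le_mul_right _ hmean).trans ?_
  rw [mul_assoc, mul_left_comm _ (r ^ (k - 1))]
  exact Nat.mul_le_mul_left _ hsum
end

section
/- Let N ≥ 7, let m ≥ 1 and k = 2m+1, and let a_1, …, a_k be nonzero integers each coprime to N. Define f, g : ℤ/Nℤ → ℝ by f(0) = 1/3 − 2(N−1)/N², f(u) = 1/3 + 2/N² for u ≠ 0, g(0) = 1/3 + (N−1)/N², and g(u) = 1/3 − 1/N² for u ≠ 0. Then: (i) f, g, and 1 − f − g all take values in [0,1]; and (ii) Σ_{(x_1,…,x_k) ∈ (ℤ/Nℤ)^k, a_1x_1 + ⋯ + a_kx_k = 0} [ f(x_1)⋯f(x_k) + g(x_1)⋯g(x_k) + (1−f−g)(x_1)⋯(1−f−g)(x_k) ] < N^{k−1} / 3^{k−1}. (These f, g, 1−f−g define a probabilistic 3-coloring of ℤ/Nℤ whose expected proportion of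 monochromatic solutions is strictly less than that of a uniformly random 3-coloring.) -/
/-- Over a finite commutative ring with `n` elements, a function equal to `A` off the origin and
`A + B` at the origin has total mass `n * A + B`, and its weighted count of solutions of a linear
equation with unit coefficients depends on the right-hand side only through its vanishing. -/
theorem sum_prod_perturbed_const {R : Type*} [CommRing R] [Fintype R] [DecidableEq R]
    (A B : ℝ) (k : ℕ) (b : Fin k → R) (hb : ∀ i, IsUnit (b i)) (c : R) :
    ∑ x : Fin k → R, (if ∑ i, b i * x i = c then ∏ i, (A + if x i = 0 then B else 0) else 0) =
      ((Fintype.card R * A + B) ^ k - B ^ k) / Fintype.card R + if c = 0 then B ^ k else 0 := by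
  have hn : (Fintype.card R : ℝ) ≠ 0 := Nat.cast_ne_zero.mpr Fintype.card_ne_zero
  induction k generalizing c with
  | zero => simp [eq_comm]
  | succ k ih =>
    obtain ⟨v, hv⟩ := hb 0
    have hzero (y : R) : c - b 0 * y = 0 ↔ y = ↑v⁻¹ * c := by
      rw [sub_eq_zero, ← hv, eq_comm, Units.eq_inv_mul_iff_mul_eq]
    have hinv : (↑v⁻¹ * c = 0) ↔ c = 0 := by simp
    rw [← (Fin.consEquiv fun _ : Fin (k + 1) => R).sum_comp, Fintype.sum_prod_type]
    have step (y : R) :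
        (∑ x : Fin k → R, if ∑ i, b i * Fin.consEquiv (fun _ => R) (y, x) i = c then
          ∏ i, (A + if Fin.consEquiv (fun _ => R) (y, x) i = 0 then B else 0) else 0) =
        (A + if y = 0 then B else 0) *
          (((Fintype.card R * A + B) ^ k - B ^ k) / Fintype.card R +
            if y = ↑v⁻¹ * c then B ^ k else 0) := by
      simp_rw [← hzero]
      rw [← ih (fun i => b i.succ) (fun i => hb i.succ), Finset.mul_sum]
      refine Finset.sum_congr rfl fun x _ => ?_
      simp [Fin.consEquiv, Fin.sum_univ_succ, Fin.prod_univ_succ, eq_sub_iff_add_eq', mul_ite]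
    simp_rw [step, mul_add, Finset.sum_add_distrib, ← Finset.sum_mul, Finset.sum_add_distrib,
      mul_ite, mul_zero, Finset.sum_ite_eq', Finset.mem_univ, if_true, hinv]
    simp only [Finset.sum_const, Finset.card_univ, nsmul_eq_mul]
    split_ifs <;> field_simp <;> ring


/-- The explicit probabilistic 3-coloring of `ℤ/Nℤ` given by
`f(0) = 1/3 - 2(N-1)/N²`, `f(u) = 1/3 + 2/N²` for `u ≠ 0`,
`g(0) = 1/3 + (N-1)/N²`, `g(u) = 1/3 - 1/N²` for `u ≠ 0`
takes values in `[0,1]` (together with `1 - f - g`), and its expected number of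
monochromatic solutions of an odd-length equation with coefficients coprime to `N`
is strictly less than `N^(k-1)/3^(k-1)`. -/
theorem explicit_three_coloring_uncommon
    (N : ℕ) [NeZero N] (hN : 7 ≤ N)
    (m : ℕ) (hm : 1 ≤ m) (k : ℕ) (hk : k = 2 * m + 1)
    (a : Fin k → ℤ) (ha : ∀ i, a i ≠ 0) (hcop : ∀ i, Int.gcd (a i) N = 1)
    (f g : ZMod N → ℝ)
    (hf0 : f 0 = 1 / 3 - 2 * ((N : ℝ) - 1) / (N : ℝ) ^ 2)
    (hf : ∀ u : ZMod N, u ≠ 0 → f u = 1 / 3 + 2 / (N : ℝ) ^ 2)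
    (hg0 : g 0 = 1 / 3 + ((N : ℝ) - 1) / (N : ℝ) ^ 2)
    (hg : ∀ u : ZMod N, u ≠ 0 → g u = 1 / 3 - 1 / (N : ℝ) ^ 2) :
    (∀ u : ZMod N,
      f u ∈ Set.Icc (0 : ℝ) 1 ∧ g u ∈ Set.Icc (0 : ℝ) 1 ∧
        (1 - f u - g u) ∈ Set.Icc (0 : ℝ) 1) ∧
    ∑ x ∈ Finset.univ.filter (fun x : Fin k → ZMod N => ∑ i, (a i : ZMod N) * x i = 0),
        ((∏ i, f (x i)) + (∏ i, g (x i)) + ∏ i, (1 - f (x i) - g (x i)))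
      < (N : ℝ) ^ (k - 1) / 3 ^ (k - 1) := by
  have hN' : (7 : ℝ) ≤ N := by exact_mod_cast hN
  have hN0 : (N : ℝ) ≠ 0 := by positivity
  have hf' (u : ZMod N) : f u = (1 / 3 + 2 / (N : ℝ) ^ 2) + if u = 0 then -2 / (N : ℝ) else 0 := by
    by_cases hu : u = 0
    · subst hu
      rw [hf0, if_pos rfl]
      field_simp
      ring
    · rw [hf u hu, if_neg hu, add_zero]
  have hg' (u : ZMod N) : g u = (1 / 3 - 1 / (N : ℝ) ^ 2) + if u = 0 then 1 / (N : ℝ) else 0 := by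
    by_cases hu : u = 0
    · subst hu
      rw [hg0, if_pos rfl]
      field_simp
      ring
    · rw [hg u hu, if_neg hu, add_zero]
  have hthird (u : ZMod N) : 1 - f u - g u = g u := by
    rw [hf', hg']
    split_ifs <;> field_simp <;> ring
  have hb (i : Fin k) : IsUnit (a i : ZMod N) :=
    (ZMod.coe_int_isUnit_iff_isCoprime _ _).mpr (Int.isCoprime_iff_gcd_eq_one.mpr (hcop i)).symm
  constructor
  · have hfu (u : ZMod N) : f u ∈ Set.Icc (0 : ℝ) 1 := by
      by_cases hu : u = 0
      · have h1 : 2 * ((N : ℝ) - 1) / (N : ℝ) ^ 2 ≤ 1 / 3 := by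
          rw [div_le_div_iff₀ (by positivity) (by norm_num)]
          nlinarith
        have h2 : 0 ≤ 2 * ((N : ℝ) - 1) / (N : ℝ) ^ 2 := div_nonneg (by linarith) (by positivity)
        rw [hu, hf0]
        constructor <;> linarith
      · have h1 : 2 / (N : ℝ) ^ 2 ≤ 1 / 3 := by
          rw [div_le_div_iff₀ (by positivity) (by norm_num)]
          nlinarith
        have h2 : 0 ≤ 2 / (N : ℝ) ^ 2 := by positivity
        rw [hf u hu]
        constructor <;> linarith
    have hgu (u : ZMod N) : g u ∈ Set.Icc (0 : ℝ) 1 := by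
      have h := hthird u
      obtain ⟨h0, h1⟩ := hfu u
      constructor <;> linarith
    exact fun u => ⟨hfu u, hgu u, (hthird u).symm ▸ hgu u⟩
  · simp_rw [hthird, Finset.sum_filter]
    have hF := sum_prod_perturbed_const (1 / 3 + 2 / (N : ℝ) ^ 2) (-2 / (N : ℝ)) k
      (fun i => (a i : ZMod N)) hb 0
    have hG := sum_prod_perturbed_const (1 / 3 - 1 / (N : ℝ) ^ 2) (1 / (N : ℝ)) k
      (fun i => (a i : ZMod N)) hb 0
    simp_rw [← hf', ZMod.card] at hF
    simp_rw [← hg', ZMod.card] at hG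
    have split (p : Prop) [Decidable p] (s t : ℝ) : (if p then s + t + t else 0) =
        (if p then s else 0) + (if p then t else 0) + (if p then t else 0) := by
      split_ifs <;> simp
    simp_rw [split, Finset.sum_add_distrib, hF, hG]
    have e1 : (N : ℝ) * (1 / 3 + 2 / (N : ℝ) ^ 2) + -2 / (N : ℝ) = N / 3 := by
      field_simp; ring
    have e2 : (N : ℝ) * (1 / 3 - 1 / (N : ℝ) ^ 2) + 1 / (N : ℝ) = N / 3 := by
      field_simp; ring
    have hmain : ((N : ℝ) / 3) ^ k * 3 / N = (N : ℝ) ^ (k - 1) / 3 ^ (k - 1) := by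
      rw [hk, Nat.add_sub_cancel, pow_succ, div_pow]
      field_simp
    have hpow : (-2 / (N : ℝ)) ^ k = -(2 ^ k * (1 / (N : ℝ)) ^ k) := by
      rw [← mul_pow, ← Odd.neg_pow ⟨m, hk⟩]
      ring
    have htwo : (2 : ℝ) < 2 ^ k := by
      simpa using pow_lt_pow_right₀ (one_lt_two (α := ℝ)) (show 1 < k by omega)
    have hdelta : 0 < (2 ^ k - 2) * (1 / (N : ℝ)) ^ k * (1 - 1 / N) := by
      have : 1 / (N : ℝ) < 1 := by rw [div_lt_one] <;> linarith
      have : 0 < (1 / (N : ℝ)) ^ k := by positivity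
      refine mul_pos (mul_pos ?_ this) ?_ <;> linarith
    rw [e1, e2, hpow, ← hmain]
    simp only [if_true]
    refine sub_pos.mp (hdelta.trans_eq ?_)
    ring
end
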